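/- Let either θ ∈ [0,1] and a ≥ 0, or θ ∈ [-1,0) and -θ ≤ a ≤ -1/θ. Then for every n ≥ 0 one has p_n^a(θ) = (−1/(1+a))^{n+1} · ∑_{k=0}^{n+1} φ_{n+1-k}(θ) · (θ^{k(k-1)/2}/k!) · (−a)^k. -/

import Mathlib

open MeasureTheory Set

/-- Persistence probability `p_n^a(θ)` for the MA(1) process with uniform
innovations on `[-a,1]`. -/
noncomputable def persprob (a θ : ℝ) : ℕ → ℝ
  | 0 => 1
  | n + 1 =>
    (volume {x : Fin (n + 2) → ℝ |
        (∀ i, x i ∈ Icc (-a) 1) ∧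
        ∀ i : Fin (n + 1), θ * x i.castSucc ≤ x i.succ}).toReal / (1 + a) ^ (n + 2)

/-- `φ_ℓ(θ)`: the sum over all `ℓ`-profiles `r = (r_1,…,r_ℓ)` (nonnegative
integers with `∑ i·r_i = ℓ`, so that necessarily `r_i ≤ ℓ`) of
`((∑ r_i)! / (r_1!⋯r_ℓ!)) · ∏_i (−θ^{i(i−1)/2}/i!)^{r_i}`, with `φ_0(θ) := 1`.
Here `i : Fin ℓ` encodes the index `i+1 ∈ {1,…,ℓ}`. -/
noncomputable def phiR (θ : ℝ) : ℕ → ℝ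
  | 0 => 1
  | ℓ + 1 =>
    ∑ r ∈ Finset.univ.filter
        (fun r : Fin (ℓ + 1) → Fin (ℓ + 2) =>
          ∑ i : Fin (ℓ + 1), (i.1 + 1) * (r i).1 = ℓ + 1),
      (((∑ i : Fin (ℓ + 1), (r i).1).factorial : ℝ) /
          ∏ i : Fin (ℓ + 1), ((r i).1.factorial : ℝ)) *
        ∏ i : Fin (ℓ + 1),
          (-(θ ^ ((i.1 + 1) * i.1 / 2)) / (((i.1 + 1).factorial : ℕ) : ℝ)) ^ (r i).1

/-- The coefficient `θ^{k(k-1)/2} / k!`. -/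
noncomputable def qexpCoeff (θ : ℝ) (k : ℕ) : ℝ :=
  θ ^ (k * (k - 1) / 2) / k.factorial

lemma qexpCoeff_zero (θ : ℝ) : qexpCoeff θ 0 = 1 := by simp [qexpCoeff]

lemma qexpCoeff_succ_mul (θ : ℝ) (k : ℕ) :
    qexpCoeff θ (k + 1) * (k + 1) = qexpCoeff θ k * θ ^ k := by
  have h : (k + 1) * (k + 1 - 1) / 2 = k * (k - 1) / 2 + k := by
    have := Finset.sum_range_id_mul_two k
    have h2 := Finset.sum_range_id_mul_two (k + 1)
    rw [Finset.sum_range_succ] at h2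
    omega
  have hk : (k.factorial : ℝ) ≠ 0 := by positivity
  have hk1 : (k : ℝ) + 1 ≠ 0 := by positivity
  rw [qexpCoeff, qexpCoeff, h, Nat.factorial_succ, pow_add]
  push_cast
  field_simp

section PowerSeries

open PowerSeries

/-- The coefficients of powers of a power series without constant term, as sums over profiles. -/
lemma sum_coeff_pow_eq_sum_profiles (c : ℕ → ℝ) (ℓ : ℕ) :
    ∑ s ∈ Finset.range (ℓ + 1),
        coeff ℓ ((X * PowerSeries.mk c : PowerSeries ℝ) ^ s) =
      ∑ r ∈ Finset.univ.filter
        (fun r : Fin ℓ → Fin (ℓ + 1) => ∑ i : Fin ℓ, (i.1 + 1) * (r i).1 = ℓ),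
      (((∑ i : Fin ℓ, (r i).1).factorial : ℝ) / ∏ i : Fin ℓ, ((r i).1.factorial : ℝ)) *
        ∏ i : Fin ℓ, c i.1 ^ (r i).1 := by
  set A : PowerSeries ℝ := ∑ i : Fin ℓ, C (c i.1) * X ^ (i.1 + 1) with hA
  have htrunc : (X : PowerSeries ℝ) ^ (ℓ + 1) ∣ X * PowerSeries.mk c - A := by
    rw [X_pow_dvd_iff]
    intro m hm
    rw [map_sub, sub_eq_zero, hA, map_sum]
    cases m with
    | zero => simp [coeff_X_pow]
    | succ m =>
      rw [coeff_succ_X_mul, coeff_mk, Finset.sum_eq_single (⟨m, by omega⟩ : Fin ℓ)]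
      · simp [coeff_X_pow]
      · intro b _ hb
        have : m ≠ b.1 := fun h => hb (Fin.ext h.symm)
        simp [coeff_X_pow, this]
      · simp
  have hpow (s : ℕ) : coeff ℓ ((X * PowerSeries.mk c : PowerSeries ℝ) ^ s) = coeff ℓ (A ^ s) := by
    have := htrunc.trans (sub_dvd_pow_sub_pow (X * PowerSeries.mk c) A s)
    rw [X_pow_dvd_iff] at this
    simpa [sub_eq_zero] using this ℓ (by omega)
  have hcoeff (s : ℕ) : coeff ℓ (A ^ s) =
      ∑ k ∈ (Finset.piAntidiag Finset.univ s).filter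
        (fun k : Fin ℓ → ℕ => ∑ i : Fin ℓ, (i.1 + 1) * k i = ℓ),
        (Nat.multinomial Finset.univ k : ℝ) * ∏ i : Fin ℓ, c i.1 ^ k i := by
    rw [hA, Finset.sum_pow_eq_sum_piAntidiag, map_sum, Finset.sum_filter]
    refine Finset.sum_congr rfl fun k _ => ?_
    have : ((Nat.multinomial Finset.univ k : ℕ) : PowerSeries ℝ) *
        ∏ i : Fin ℓ, (C (c i.1) * X ^ (i.1 + 1)) ^ k i =
        C ((Nat.multinomial Finset.univ k : ℝ) * ∏ i : Fin ℓ, c i.1 ^ k i) *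
          X ^ (∑ i : Fin ℓ, (i.1 + 1) * k i) := by
      simp_rw [mul_pow, Finset.prod_mul_distrib, ← pow_mul, Finset.prod_pow_eq_pow_sum]
      simp [mul_assoc]
    rw [this, coeff_C_mul, coeff_X_pow]
    simp [eq_comm]
  simp_rw [hpow, hcoeff]
  rw [Finset.sum_sigma']
  symm
  refine Finset.sum_bij (fun r _ => ⟨∑ i, (r i).1, fun i => (r i).1⟩) ?_ ?_ ?_ ?_
  · intro r hr
    simp only [Finset.mem_filter, Finset.mem_univ, true_and] at hr
    simp only [Finset.mem_sigma, Finset.mem_range, Finset.mem_filter, Finset.mem_piAntidiag]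
    refine ⟨?_, ⟨by simp, by simp⟩, hr⟩
    have : ∑ i, (r i).1 ≤ ∑ i : Fin ℓ, (i.1 + 1) * (r i).1 :=
      Finset.sum_le_sum fun i _ => Nat.le_mul_of_pos_left _ (Nat.succ_pos _)
    omega
  · intro r _ r' _ h
    simp only [Sigma.mk.injEq, heq_eq_eq] at h
    funext i
    exact Fin.ext (congrFun h.2 i)
  · rintro ⟨s, k⟩ hk
    simp only [Finset.mem_sigma, Finset.mem_range, Finset.mem_filter,
      Finset.mem_piAntidiag] at hk
    obtain ⟨-, ⟨rfl, -⟩, hk⟩ := hk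
    have hle (i : Fin ℓ) : k i < ℓ + 1 := by
      have h1 := Finset.single_le_sum (f := fun i : Fin ℓ => (i.1 + 1) * k i)
        (fun _ _ => Nat.zero_le _) (Finset.mem_univ i)
      have h2 : k i ≤ (i.1 + 1) * k i := Nat.le_mul_of_pos_left _ (Nat.succ_pos _)
      omega
    exact ⟨fun i => ⟨k i, hle i⟩, by simpa using hk, rfl⟩
  · intro r _
    congr 1
    rw [div_eq_iff (by positivity)]
    have := Nat.multinomial_spec Finset.univ (fun i => (r i).1)
    rw [mul_comm]
    exact_mod_cast this.symm

lemma phiR_eq_sum_coeff_pow (θ : ℝ) (ℓ : ℕ) :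
    phiR θ ℓ = ∑ s ∈ Finset.range (ℓ + 1),
      coeff ℓ ((X * PowerSeries.mk fun i => -qexpCoeff θ (i + 1) : PowerSeries ℝ) ^ s) := by
  cases ℓ with
  | zero => simp [phiR]
  | succ ℓ =>
    rw [sum_coeff_pow_eq_sum_profiles]
    simp [phiR, qexpCoeff, neg_div]

/-- `∑ φ_ℓ z^ℓ` is the multiplicative inverse of `∑ θ^{k(k-1)/2} z^k / k!`. -/
lemma sum_phiR_mul_qexpCoeff_eq_zero (θ : ℝ) {m : ℕ} (hm : m ≠ 0) :
    ∑ k ∈ Finset.range (m + 1), phiR θ (m - k) * qexpCoeff θ k = 0 := by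
  set P : PowerSeries ℝ := X * PowerSeries.mk fun i => -qexpCoeff θ (i + 1) with hP
  have hvanish {ℓ s : ℕ} (h : ℓ < s) : coeff ℓ (P ^ s) = 0 := by
    have : (X : PowerSeries ℝ) ^ s ∣ P ^ s := pow_dvd_pow_of_dvd (Dvd.intro _ rfl) s
    exact X_pow_dvd_iff.1 this ℓ h
  have hphi {ℓ : ℕ} (h : ℓ ≤ m) :
      phiR θ ℓ = coeff ℓ (∑ s ∈ Finset.range (m + 1), P ^ s) := by
    rw [phiR_eq_sum_coeff_pow, map_sum]
    refine Finset.sum_subset (Finset.range_subset_range.2 (by omega)) fun s _ hs => ?_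
    exact hvanish (by simpa using hs)
  have hE (k : ℕ) : qexpCoeff θ k = coeff k (1 - P) := by
    cases k with
    | zero => simp [hP, qexpCoeff_zero]
    | succ k => simp [hP, coeff_succ_X_mul, coeff_one]
  have hgeom := congrArg (coeff m) (mul_neg_geom_sum P (m + 1))
  rw [coeff_mul, Finset.Nat.sum_antidiagonal_eq_sum_range_succ_mk, map_sub,
    hvanish (Nat.lt_succ_self m), coeff_one, if_neg hm, sub_zero] at hgeom
  rw [← hgeom]
  refine Finset.sum_congr rfl fun k _ => ?_
  rw [hphi (Nat.sub_le m k), hE, mul_comm]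

end PowerSeries

/-- The polynomial `∑_k φ_{m-k}(θ) θ^{k(k-1)/2} t^k / k!`. -/
noncomputable def persPoly (θ : ℝ) (m : ℕ) (t : ℝ) : ℝ :=
  ∑ k ∈ Finset.range (m + 1), phiR θ (m - k) * qexpCoeff θ k * t ^ k

lemma persPoly_zero (θ t : ℝ) : persPoly θ 0 t = 1 := by
  simp [persPoly, phiR, qexpCoeff_zero]

lemma persPoly_succ_one (θ : ℝ) (m : ℕ) : persPoly θ (m + 1) 1 = 0 := by
  simpa [persPoly] using sum_phiR_mul_qexpCoeff_eq_zero θ m.succ_ne_zero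

lemma continuous_persPoly (θ : ℝ) (m : ℕ) : Continuous (persPoly θ m) := by
  unfold persPoly
  fun_prop

lemma hasDerivAt_persPoly_succ (θ : ℝ) (m : ℕ) (t : ℝ) :
    HasDerivAt (persPoly θ (m + 1)) (persPoly θ m (θ * t)) t := by
  have h : HasDerivAt (persPoly θ (m + 1)) (∑ k ∈ Finset.range (m + 2),
      phiR θ (m + 1 - k) * qexpCoeff θ k * (k * t ^ (k - 1))) t :=
    HasDerivAt.fun_sum fun k _ => (hasDerivAt_pow k t).const_mul _
  convert h using 1
  rw [Finset.sum_range_succ', persPoly]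
  simp only [Nat.cast_zero, zero_mul, mul_zero, add_zero]
  refine Finset.sum_congr rfl fun k _ => ?_
  rw [Nat.add_sub_add_right, Nat.add_sub_cancel]
  push_cast
  linear_combination -phiR θ (m - k) * t ^ k * qexpCoeff_succ_mul θ k

lemma integral_persPoly (θ : ℝ) (m : ℕ) (t : ℝ) :
    ∫ y in t..1, (-1) ^ m * persPoly θ m (θ * y) = (-1) ^ (m + 1) * persPoly θ (m + 1) t := by
  rw [intervalIntegral.integral_const_mul,
    intervalIntegral.integral_eq_sub_of_hasDerivAt
      (fun y _ => hasDerivAt_persPoly_succ θ m y)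
      (((continuous_persPoly θ m).comp (by fun_prop)).intervalIntegrable _ _),
    persPoly_succ_one]
  ring

/-- The vectors `x ∈ ℝ^m` with `t ≤ x_1 ≤ 1` and `θ x_i ≤ x_{i+1} ≤ 1`. -/
def chainSet (θ : ℝ) : (m : ℕ) → ℝ → Set (Fin m → ℝ)
  | 0, _ => univ
  | m + 1, t => {x | x 0 ∈ Icc t 1 ∧ Fin.tail x ∈ chainSet θ m (θ * x 0)}

lemma isClosed_chainSet_graph (θ : ℝ) (m : ℕ) :
    IsClosed {p : ℝ × (Fin m → ℝ) | p.2 ∈ chainSet θ m p.1} := by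
  induction m with
  | zero => simp [chainSet]
  | succ m ih =>
    simp only [chainSet, mem_Icc, ofPred_and]
    refine ((isClosed_le (by fun_prop) (by fun_prop)).inter
      (isClosed_le (by fun_prop) (by fun_prop))).inter ?_
    exact ih.preimage (f := fun p : ℝ × (Fin (m + 1) → ℝ) => (θ * p.2 0, Fin.tail p.2))
      (by unfold Fin.tail; fun_prop)

lemma volume_chainSet_succ (θ : ℝ) (m : ℕ) (t : ℝ) :
    volume (chainSet θ (m + 1) t) = ∫⁻ y in Icc t 1, volume (chainSet θ m (θ * y)) := by
  have hclosed : IsClosed {p : ℝ × (Fin m → ℝ) |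
      p.1 ∈ Icc t 1 ∧ p.2 ∈ chainSet θ m (θ * p.1)} :=
    (isClosed_Icc.preimage continuous_fst).inter
      ((isClosed_chainSet_graph θ m).preimage
        (f := fun p : ℝ × (Fin m → ℝ) => (θ * p.1, p.2)) (by fun_prop))
  have hpre := (volume_preserving_piFinSuccAbove (fun _ : Fin (m + 1) => ℝ) 0).measure_preimage
    hclosed.measurableSet.nullMeasurableSet
  have hset : chainSet θ (m + 1) t =
      MeasurableEquiv.piFinSuccAbove (fun _ : Fin (m + 1) => ℝ) 0 ⁻¹'
        {p : ℝ × (Fin m → ℝ) | p.1 ∈ Icc t 1 ∧ p.2 ∈ chainSet θ m (θ * p.1)} := by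
    ext x
    rfl
  rw [hset, hpre, Measure.volume_eq_prod, Measure.prod_apply hclosed.measurableSet,
    ← lintegral_indicator measurableSet_Icc]
  refine lintegral_congr fun y => ?_
  by_cases hy : y ∈ Icc t 1
  · simp only [indicator_of_mem hy]
    congr 1
    ext x
    simp [hy.1, hy.2]
  · simp only [indicator_of_notMem hy]
    convert measure_empty (μ := (volume : Measure (Fin m → ℝ)))
    ext x
    simp only [mem_preimage, mem_ofPred_eq, hy, false_and, mem_empty_iff_false]

lemma volume_chainSet {a θ : ℝ} (hθ : MapsTo (θ * ·) (Icc (-a) 1) (Icc (-a) 1)) (m : ℕ) :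
    ∀ t ∈ Icc (-a) 1, 0 ≤ (-1) ^ m * persPoly θ m t ∧
      volume (chainSet θ m t) = ENNReal.ofReal ((-1) ^ m * persPoly θ m t) := by
  induction m with
  | zero => simp [persPoly_zero, chainSet, volume_pi]
  | succ m ih =>
    intro t ht
    have hsub {y : ℝ} (hy : y ∈ Icc t 1) : θ * y ∈ Icc (-a) 1 := hθ ⟨ht.1.trans hy.1, hy.2⟩
    have hcont : Continuous fun y => (-1) ^ m * persPoly θ m (θ * y) :=
      ((continuous_persPoly θ m).comp (by fun_prop)).const_mul _
    rw [← integral_persPoly]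
    refine ⟨intervalIntegral.integral_nonneg ht.2 fun y hy => (ih _ (hsub hy)).1, ?_⟩
    rw [volume_chainSet_succ, intervalIntegral.integral_of_le ht.2,
      ← integral_Icc_eq_integral_Ioc,
      ofReal_integral_eq_lintegral_ofReal hcont.continuousOn.integrableOn_Icc
        ((ae_restrict_iff' measurableSet_Icc).2 (.of_forall fun y hy => (ih _ (hsub hy)).1))]
    exact setLIntegral_congr_fun measurableSet_Icc fun y hy => (ih _ (hsub hy)).2

lemma mem_chainSet_succ_iff {a θ : ℝ} (hθ : MapsTo (θ * ·) (Icc (-a) 1) (Icc (-a) 1)) (m : ℕ) :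
    ∀ t ∈ Icc (-a) 1, ∀ x : Fin (m + 1) → ℝ, x ∈ chainSet θ (m + 1) t ↔
      t ≤ x 0 ∧ (∀ i, x i ∈ Icc (-a) 1) ∧ ∀ i : Fin m, θ * x i.castSucc ≤ x i.succ := by
  induction m with
  | zero =>
    intro t ht x
    constructor
    · rintro ⟨h, -⟩
      refine ⟨h.1, fun i => ?_, fun i => i.elim0⟩
      rw [show i = 0 from Fin.fin_one_eq_zero i]
      exact ⟨ht.1.trans h.1, h.2⟩
    · rintro ⟨h0, h, -⟩
      exact ⟨⟨h0, (h 0).2⟩, mem_univ _⟩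
  | succ m ih =>
    intro t ht x
    rw [Fin.forall_fin_succ, Fin.forall_fin_succ (P := fun i : Fin (m + 1) =>
      θ * x i.castSucc ≤ x i.succ)]
    constructor
    · rintro ⟨h0, h⟩
      have hx0 : x 0 ∈ Icc (-a) 1 := ⟨ht.1.trans h0.1, h0.2⟩
      obtain ⟨h1, h2, h3⟩ := (ih _ (hθ hx0) _).1 h
      exact ⟨h0.1, ⟨hx0, h2⟩, h1, h3⟩
    · rintro ⟨h0, ⟨hx0, h2⟩, h1, h3⟩
      exact ⟨⟨h0, hx0.2⟩, (ih _ (hθ hx0) _).2 ⟨h1, h2, h3⟩⟩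

lemma mapsTo_mul_Icc {a θ : ℝ}
    (h : (θ ∈ Icc (0 : ℝ) 1 ∧ 0 ≤ a) ∨ (θ ∈ Ico (-1 : ℝ) 0 ∧ -θ ≤ a ∧ a ≤ -1 / θ)) :
    MapsTo (θ * ·) (Icc (-a) 1) (Icc (-a) 1) := by
  rintro y ⟨hy1, hy2⟩
  simp only [mem_Icc]
  rcases h with ⟨⟨h0, h1⟩, ha⟩ | ⟨⟨h0, h1⟩, ha, ha'⟩
  · constructor <;> nlinarith
  · rw [le_div_iff_of_neg h1] at ha'
    constructor <;> nlinarith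

theorem blue_region_combinatorial_representation (a θ : ℝ)
    (h : (θ ∈ Icc (0 : ℝ) 1 ∧ 0 ≤ a) ∨
      (θ ∈ Ico (-1 : ℝ) 0 ∧ -θ ≤ a ∧ a ≤ -1 / θ)) :
    ∀ n : ℕ,
      persprob a θ n =
        (-1 / (1 + a)) ^ (n + 1) *
          ∑ k ∈ Finset.range (n + 2),
            phiR θ (n + 1 - k) * (θ ^ (k * (k - 1) / 2) / k.factorial) * (-a) ^ k := by
  have hθ := mapsTo_mul_Icc h
  have ha : 0 ≤ a := by
    rcases h with ⟨-, h⟩ | ⟨⟨-, h1⟩, h2, -⟩ <;> linarith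
  intro n
  change _ = (-1 / (1 + a)) ^ (n + 1) * persPoly θ (n + 1) (-a)
  have hmem : -a ∈ Icc (-a) 1 := ⟨le_rfl, by linarith⟩
  cases n with
  | zero =>
    have h1 := persPoly_succ_one θ 0
    simp only [persPoly, Finset.sum_range_succ, Finset.sum_range_zero] at h1 ⊢
    have hφ : phiR θ 0 = 1 := rfl
    have hq : qexpCoeff θ 1 = 1 := by simp [qexpCoeff]
    have ha1 : 1 + a ≠ 0 := by positivity
    simp [qexpCoeff_zero, hφ, hq] at h1 ⊢
    rw [persprob, eq_neg_of_add_eq_zero_left h1]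
    field_simp
    ring
  | succ n =>
    obtain ⟨hnn, hvol⟩ := volume_chainSet hθ (n + 2) (-a) hmem
    have hset : {x : Fin (n + 2) → ℝ | (∀ i, x i ∈ Icc (-a) 1) ∧
        ∀ i : Fin (n + 1), θ * x i.castSucc ≤ x i.succ} = chainSet θ (n + 2) (-a) := by
      ext x
      rw [mem_chainSet_succ_iff hθ _ _ hmem]
      exact ⟨fun hx => ⟨(hx.1 0).1, hx⟩, fun hx => hx.2⟩
    rw [persprob, hset, hvol, ENNReal.toReal_ofReal hnn, div_pow]
    ring
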